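/- Let N_n, g ∈ ℝ³, let R₁, R_k be rotation matrices, and let Γ₅ ∈ ℝ³ˣ³ be arbitrary. Over the 25-dimensional point–line–plane state, define the orientation-measurement block row B = R_kᵀ·[⌊N_n×⌋R₁, Γ₅, 0₃ₓ₃, 0₃ₓ₃, 0₃ₓ₃, 0₃ₓ₃, 0₃ₓ₃, 0₃ₓ₁, 0₃ₓ₃]. Let N_{plπ} be the 4-column unobservable-direction matrix of the point–line–plane aided INS (column 1 the rotation-about-gravity direction, columns 2–4 the translation directions). Then B applied to columns 2–4 of N_{plπ} is zero, while B applied to column 1 equals R_kᵀ(N_n × g). Consequently, the rotation-about-gravity direction lies in the null space of the observability matrix augmented with global orientation measurements of direction N_n if and only if N_n × g = 0, i.e., if and only if the measured direction is parallel to gravity. -/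

import Mathlib

open Matrix

noncomputable section

abbrev V3 : Type := Fin 3 → ℝ
abbrev M3 : Type := Matrix (Fin 3) (Fin 3) ℝ

/-- The skew-symmetric cross-product matrix `⌊v×⌋`. -/
def skew (v : V3) : M3 :=
  !![0, -(v 2), v 1; v 2, 0, -(v 0); -(v 1), v 0, 0]

/-- `R` is a rotation matrix: `RᵀR = I₃` and `det R = 1`. -/
def IsRot (R : M3) : Prop := Rᵀ * R = 1 ∧ R.det = 1

/-- Euclidean norm on `ℝ³`. -/
def norm3 (v : V3) : ℝ := Real.sqrt (v ⬝ᵥ v)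

def e1 : V3 := ![1, 0, 0]
def e2 : V3 := ![0, 1, 0]
def e3 : V3 := ![0, 0, 1]

/-- The 3×3 matrix with the given columns. -/
def cols3 (a b c : V3) : M3 := Matrix.of fun i j => ![a i, b i, c i] j

/-- The 3×3 matrix with the given rows. -/
def rows3 (a b c : V3) : M3 := Matrix.of ![a, b, c]

/-- 25-dimensional joint point–line–plane state index
(orientation, gyro bias, velocity, accel bias, position, point, δθ_L, δφ_L, plane CP). -/
abbrev S25 : Type :=
  Fin 3 ⊕ Fin 3 ⊕ Fin 3 ⊕ Fin 3 ⊕ Fin 3 ⊕ Fin 3 ⊕ Fin 3 ⊕ Fin 1 ⊕ Fin 3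

/-- The 3×25 block row `[A B C D E F G w Hm]`. -/
def rowPLP (A B C D E F G : M3) (w : V3) (Hm : M3) : Matrix (Fin 3) S25 ℝ :=
  Matrix.of fun i =>
    Sum.elim (fun j => A i j) (Sum.elim (fun j => B i j) (Sum.elim (fun j => C i j)
      (Sum.elim (fun j => D i j) (Sum.elim (fun j => E i j)
        (Sum.elim (fun j => F i j) (Sum.elim (fun j => G i j)
          (Sum.elim (fun _ => w i) (fun j => Hm i j))))))))

/-- The stacked vector `(a; b; c; d; e; f; g'; s; h)` in ℝ²⁵. -/
def colPLP (a b c d e f g' : V3) (s : ℝ) (h : V3) : S25 → ℝ :=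
  Sum.elim a (Sum.elim b (Sum.elim c (Sum.elim d (Sum.elim e
    (Sum.elim f (Sum.elim g' (Sum.elim (fun _ => s) h)))))))

/-- The 25×3 stacked blocks `(A; B; C; D; E; F; G; r; Hm)`. -/
def stackPLP (A B C D E F G : M3) (r : V3) (Hm : M3) : Matrix S25 (Fin 3) ℝ :=
  Matrix.of (Sum.elim (fun i => A i) (Sum.elim (fun i => B i) (Sum.elim (fun i => C i)
    (Sum.elim (fun i => D i) (Sum.elim (fun i => E i)
      (Sum.elim (fun i => F i) (Sum.elim (fun i => G i)
        (Sum.elim (fun _ => r) (fun i => Hm i)))))))))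


theorem rowPLP_mulVec_colPLP_eq (A B : M3) (a c d e f g' : V3) (s : ℝ) (h : V3) :
    rowPLP A B 0 0 0 0 0 0 0 *ᵥ colPLP a 0 c d e f g' s h = A *ᵥ a := by
  ext i
  simp [rowPLP, colPLP, mulVec, dotProduct, Fintype.sum_sum_type]

theorem rowPLP_mul_stackPLP_eq_zero (A B C D E F G : M3) (r : V3) (H : M3) :
    rowPLP A B 0 0 0 0 0 0 0 * stackPLP 0 0 C D E F G r H = 0 := by
  ext i j
  simp [rowPLP, stackPLP, mul_apply, Fintype.sum_sum_type]

theorem IsRot.mul_transpose {R : M3} (hR : IsRot R) : R * Rᵀ = 1 :=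
  mul_eq_one_comm.mp hR.1

theorem IsRot.transpose_mulVec_eq_zero_iff {R : M3} (hR : IsRot R) (v : V3) :
    Rᵀ *ᵥ v = 0 ↔ v = 0 := by
  refine ⟨fun h => ?_, fun h => by rw [h, mulVec_zero]⟩
  rw [← one_mulVec v, ← hR.mul_transpose, ← mulVec_mulVec, h, mulVec_zero]

/-- a global orientation measurement of direction `N_n` annihilates the
translation directions, and maps the rotation-about-gravity direction to
`R_kᵀ(N_n × g)`; that direction stays unobservable iff `N_n × g = 0`. -/
theorem global_orientation_measurement_observability
    (Nn nL vL n np1 np2 g Pf P₁ V₁ Pk : V3) (d : ℝ)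
    (R₁ Rk : M3) (hR₁ : IsRot R₁) (hRk : IsRot Rk) (Γ₅ : M3)
    (hnL : nL ≠ 0) (hvL : vL ≠ 0) (horth : nL ⬝ᵥ vL = 0)
    (hn : norm3 n = 1) (hd : d ≠ 0)
    (h11 : np1 ⬝ᵥ np1 = 1) (h22 : np2 ⬝ᵥ np2 = 1) (h12 : np1 ⬝ᵥ np2 = 0)
    (h1n : np1 ⬝ᵥ n = 0) (h2n : np2 ⬝ᵥ n = 0) :
    let w₁ : ℝ := norm3 nL
    let w₂ : ℝ := norm3 vL
    let nE : V3 := w₁⁻¹ • nL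
    let vE : V3 := w₂⁻¹ • vL
    let ηsq : ℝ := (w₁ ^ 2 + w₂ ^ 2)⁻¹
    let RL : M3 := cols3 nE vE (skew nE *ᵥ vE)
    let RPi : M3 := cols3 np1 np2 n
    let cp : V3 := d • n
    let Bm : Matrix (Fin 3) S25 ℝ :=
      Rkᵀ * rowPLP (skew Nn * R₁) Γ₅ 0 0 0 0 0 0 0
    let c1 : S25 → ℝ :=
      colPLP (R₁ᵀ *ᵥ g) 0 (-(skew V₁ *ᵥ g)) 0 (-(skew P₁ *ᵥ g))
        (-(skew Pf *ᵥ g)) (-g) 0 (-(skew cp *ᵥ g))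
    let Cm : Matrix S25 (Fin 3) ℝ :=
      stackPLP 0 0 0 0 1 1 (((w₂ / w₁) • vecMulVec vE e1) * RLᵀ)
        ((ηsq * w₂ ^ 2) • (e3 ᵥ* RLᵀ)) (vecMulVec n e3 * RPiᵀ)
    Bm * Cm = 0 ∧ Bm *ᵥ c1 = Rkᵀ *ᵥ (skew Nn *ᵥ g) ∧
      (Bm *ᵥ c1 = 0 ↔ skew Nn *ᵥ g = 0) := by
  intro w₁ w₂ nE vE ηsq RL RPi cp Bm c1 Cm
  have hc1 : Bm *ᵥ c1 = Rkᵀ *ᵥ (skew Nn *ᵥ g) := by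
    simp only [Bm, c1]
    rw [← mulVec_mulVec, rowPLP_mulVec_colPLP_eq, ← mulVec_mulVec _ (skew Nn), mulVec_mulVec g R₁,
      hR₁.mul_transpose, one_mulVec]
  refine ⟨?_, hc1, ?_⟩
  · simp only [Bm, Cm]
    rw [Matrix.mul_assoc, rowPLP_mul_stackPLP_eq_zero, Matrix.mul_zero]
  · rw [hc1, hRk.transpose_mulVec_eq_zero_iff]
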